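/- arXiv:2605.28586 — 5 statements merged into one kernel-verified Lean document; each statement's English description precedes it below -/
import Mathlib

section
/- Let σ₁ and σ₂ be the two-qutrit vectors with amplitudes σ₁(y) = (1/3)·ω^{y₀² + y₀y₁ + y₁²} and σ₂(y) = (1/3)·ω^{y₀² + 2y₀y₁ + y₁²} for all y = (y₀,y₁) ∈ 𝔽₃² (exponents computed mod 3). Then |𝕊⟩^{⊗2} = −(i√3/2)·ω·(σ₁ − σ₂). In particular, both σ₁ and σ₂ are canonical 2-qutrit stabilizer states (with k = 2, x₀ = 0, W = I₂), so χ(|𝕊⟩^{⊗2}) ≤ 2. -/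
open Complex
open scoped BigOperators

noncomputable section

/-- An `m`-qutrit state is a vector of amplitudes indexed by `Fin m → ZMod 3`. -/
abbrev QS (m : ℕ) := (Fin m → ZMod 3) → ℂ

/-- The primitive cube root of unity `ω = exp(2πi/3)`. -/
def ω : ℂ := Complex.exp (2 * Real.pi * Complex.I / 3)

/-- `ω` raised to an exponent in `ZMod 3`. -/
def ωp (a : ZMod 3) : ℂ := ω ^ a.val

/-- A polynomial `Q : 𝔽₃^k → 𝔽₃` of degree at most 2. -/
def IsDeg2 {k : ℕ} (Q : (Fin k → ZMod 3) → ZMod 3) : Prop :=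
  ∃ (A : Fin k → Fin k → ZMod 3) (b : Fin k → ZMod 3) (c : ZMod 3),
    ∀ y, Q y = (∑ i, ∑ j, A i j * y i * y j) + (∑ i, b i * y i) + c

/-- `σ` is a canonical `m`-qutrit stabilizer state:
`σ = 3^{-k/2} ∑_{y ∈ 𝔽₃^k} ω^{Q(y)} |x₀ + W y⟩` with `W` injective linear and `deg Q ≤ 2`. -/
def IsStab {m : ℕ} (σ : QS m) : Prop :=
  ∃ k : ℕ, k ≤ m ∧
    ∃ (x₀ : Fin m → ZMod 3)
      (W : (Fin k → ZMod 3) →ₗ[ZMod 3] (Fin m → ZMod 3))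
      (Q : (Fin k → ZMod 3) → ZMod 3),
      Function.Injective W ∧ IsDeg2 Q ∧
      σ = fun x => ((Real.sqrt (3 ^ k) : ℝ) : ℂ)⁻¹ *
        ∑ y : Fin k → ZMod 3, if x = x₀ + W y then ωp (Q y) else 0

/-- The stabilizer rank: the least `r` such that `ψ` is a ℂ-linear combination of `r`
canonical stabilizer states. -/
def stabRank {m : ℕ} (ψ : QS m) : ℕ :=
  sInf {r : ℕ | ∃ (c : Fin r → ℂ) (σ : Fin r → QS m),
    (∀ i, IsStab (σ i)) ∧ ψ = ∑ i, c i • σ i}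

/-- The `m`-fold tensor power of a single-qutrit state. -/
def tpow (ψ : ZMod 3 → ℂ) (m : ℕ) : QS m := fun x => ∏ i, ψ (x i)

/-- The Strange state `|𝕊⟩ = (|1⟩ - |2⟩)/√2`. -/
def Strange : ZMod 3 → ℂ := fun j =>
  ((if j = 1 then 1 else 0) - (if j = 2 then 1 else 0)) / (Real.sqrt 2 : ℂ)

/-- The stabilizer state `σ₁(y) = (1/3)·ω^{y₀² + y₀y₁ + y₁²}`. -/
def σS1 : QS 2 := fun y => (1 / 3 : ℂ) * ωp (y 0 ^ 2 + y 0 * y 1 + y 1 ^ 2)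

/-- The stabilizer state `σ₂(y) = (1/3)·ω^{y₀² + 2y₀y₁ + y₁²}`. -/
def σS2 : QS 2 := fun y => (1 / 3 : ℂ) * ωp (y 0 ^ 2 + 2 * y 0 * y 1 + y 1 ^ 2)

theorem ω_eq : ω = -1 / 2 + (Real.sqrt 3 : ℂ) / 2 * Complex.I := by
  have h : (2 * Real.pi * Complex.I / 3 : ℂ) = ((Real.pi - Real.pi / 3 : ℝ) : ℂ) * Complex.I := by
    push_cast
    ring
  rw [ω, h, Complex.exp_mul_I, ← Complex.ofReal_cos, ← Complex.ofReal_sin, Real.cos_pi_sub,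
    Real.sin_pi_sub, Real.cos_pi_div_three, Real.sin_pi_div_three]
  push_cast
  ring

theorem ofReal_sqrt_sq {a : ℝ} (ha : 0 ≤ a) : (Real.sqrt a : ℂ) ^ 2 = a := by
  rw [← Complex.ofReal_pow, Real.sq_sqrt ha]

theorem ωp_zero : ωp 0 = 1 := by simp [ωp]

theorem ωp_one : ωp 1 = ω := by simp [ωp, ZMod.val_one]

/-- A full-support quadratic phase state on two qutrits is a canonical stabilizer state. -/
theorem isStab_quadratic_phase (Q : (Fin 2 → ZMod 3) → ZMod 3) (hQ : IsDeg2 Q) :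
    IsStab (fun y => (1 / 3 : ℂ) * ωp (Q y) : QS 2) := by
  refine ⟨2, le_rfl, 0, LinearMap.id, Q, fun _ _ h => h, hQ, ?_⟩
  funext x
  have h : Real.sqrt (3 ^ 2) = 3 := Real.sqrt_sq (by norm_num)
  simp [h]

theorem isStab_σS1 : IsStab σS1 := by
  refine isStab_quadratic_phase _ ⟨!![1, 1; 0, 1], 0, 0, fun y => ?_⟩
  simp [Fin.sum_univ_two]
  ring

theorem isStab_σS2 : IsStab σS2 := by
  refine isStab_quadratic_phase _ ⟨!![1, 2; 0, 1], 0, 0, fun y => ?_⟩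
  simp [Fin.sum_univ_two]
  ring

theorem tpow_strange_two :
    tpow Strange 2 = (-(Complex.I * (Real.sqrt 3 : ℂ) / 2) * ω) • (σS1 - σS2) := by
  have h2 : (Real.sqrt 2 : ℂ) ^ 2 = 2 := by
    simpa using ofReal_sqrt_sq (show (0 : ℝ) ≤ 2 by norm_num)
  have h3 : (Real.sqrt 3 : ℂ) ^ 2 = 3 := by
    simpa using ofReal_sqrt_sq (show (0 : ℝ) ≤ 3 by norm_num)
  have hω : Complex.I * (Real.sqrt 3 : ℂ) * ω * (1 - ω) = -3 := by
    rw [ω_eq]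
    grind [Complex.I_sq]
  have hprod (a b : ℂ) : a / (Real.sqrt 2 : ℂ) * (b / (Real.sqrt 2 : ℂ)) = a * b / 2 := by
    rw [div_mul_div_comm, ← sq, h2]
  funext x
  simp only [tpow, Fin.prod_univ_two, Strange, hprod, Pi.smul_apply, Pi.sub_apply, σS1, σS2,
    smul_eq_mul]
  generalize x 0 = a
  generalize x 1 = b
  have key (a b : ZMod 3) :
      (a * b = 0 ∧ (a = 0 ∨ b = 0)) ∨ (a = 1 ∧ b = 1) ∨ (a = 1 ∧ b = 2) ∨
        (a = 2 ∧ b = 1) ∨ (a = 2 ∧ b = 2) := by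
    revert a b
    decide
  have h12 : (1 : ZMod 3) ≠ 2 := by decide
  have e0 (u : ZMod 3) (hu : u = 0) : ωp u = 1 := by rw [hu, ωp_zero]
  have e1 (u : ZMod 3) (hu : u = 1) : ωp u = ω := by rw [hu, ωp_one]
  rcases key a b with ⟨hab, h⟩ | ⟨rfl, rfl⟩ | ⟨rfl, rfl⟩ | ⟨rfl, rfl⟩ | ⟨rfl, rfl⟩
  · have h01 : (0 : ZMod 3) ≠ 1 := by decide
    have h02 : (0 : ZMod 3) ≠ 2 := by decide
    rw [mul_assoc 2 a b, hab]
    rcases h with rfl | rfl <;> simp [h01, h02]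
  · rw [e0 (1 ^ 2 + 1 * 1 + 1 ^ 2) (by decide), e1 (1 ^ 2 + 2 * 1 * 1 + 1 ^ 2) (by decide)]
    simp only [h12, if_true, if_false]
    linear_combination (1 / 6 : ℂ) * hω
  · rw [e1 (1 ^ 2 + 1 * 2 + 2 ^ 2) (by decide), e0 (1 ^ 2 + 2 * 1 * 2 + 2 ^ 2) (by decide)]
    simp only [h12, h12.symm, if_true, if_false]
    linear_combination (-1 / 6 : ℂ) * hω
  · rw [e1 (2 ^ 2 + 2 * 1 + 1 ^ 2) (by decide), e0 (2 ^ 2 + 2 * 2 * 1 + 1 ^ 2) (by decide)]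
    simp only [h12, h12.symm, if_true, if_false]
    linear_combination (-1 / 6 : ℂ) * hω
  · rw [e0 (2 ^ 2 + 2 * 2 + 2 ^ 2) (by decide), e1 (2 ^ 2 + 2 * 2 * 2 + 2 ^ 2) (by decide)]
    simp only [h12.symm, if_true, if_false]
    linear_combination (1 / 6 : ℂ) * hω

theorem stabRank_le_two {m : ℕ} {ψ σ τ : QS m} (hσ : IsStab σ) (hτ : IsStab τ) (c d : ℂ)
    (h : ψ = c • σ + d • τ) : stabRank ψ ≤ 2 := by
  refine Nat.sInf_le ⟨![c, d], ![σ, τ], fun i => ?_, ?_⟩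
  · fin_cases i
    · exact hσ
    · exact hτ
  · simpa [Fin.sum_univ_two] using h

/-- `|𝕊⟩^{⊗2} = -(i√3/2)·ω·(σ₁ - σ₂)`, both `σᵢ` are canonical 2-qutrit
stabilizer states, and hence `χ(|𝕊⟩^{⊗2}) ≤ 2`. -/
theorem strange_m2_decomposition :
    tpow Strange 2 = (-(Complex.I * (Real.sqrt 3 : ℂ) / 2) * ω) • (σS1 - σS2) ∧
    IsStab σS1 ∧ IsStab σS2 ∧ stabRank (tpow Strange 2) ≤ 2 := by
  refine ⟨tpow_strange_two, isStab_σS1, isStab_σS2, ?_⟩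
  refine stabRank_le_two isStab_σS1 isStab_σS2 (-(Complex.I * (Real.sqrt 3 : ℂ) / 2) * ω)
    (-(-(Complex.I * (Real.sqrt 3 : ℂ) / 2) * ω)) ?_
  rw [tpow_strange_two, neg_smul, ← sub_eq_add_neg, smul_sub]
end
end

section
/- The two-qutrit state |𝕊⟩^{⊗2} is not a scalar multiple of any canonical 2-qutrit stabilizer state; combined with the explicit two-term decomposition of |𝕊⟩^{⊗2}, this gives χ(|𝕊⟩^{⊗2}) = 2. (Proof idea: the support of |𝕊⟩^{⊗2} is {1,2}² of cardinality 4, while the support of any canonical stabilizer state is an affine subspace of 𝔽₃² of cardinality 3^r for r ∈ {0,1,2}.) -/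
open Complex
open scoped BigOperators

noncomputable section

theorem omega_isPrimitiveRoot : IsPrimitiveRoot ω 3 := by
  simpa [ω] using Complex.isPrimitiveRoot_exp 3 (by norm_num)

theorem omega_ne_zero : ω ≠ 0 := Complex.exp_ne_zero _

theorem omega_sub_sq_ne_zero : ω - ω ^ 2 ≠ 0 := by
  have h1 : ω ≠ 1 := omega_isPrimitiveRoot.ne_one (by norm_num)
  have h : ω - ω ^ 2 = ω * (1 - ω) := by ring
  rw [h]
  exact mul_ne_zero omega_ne_zero (sub_ne_zero.2 h1.symm)

/-- The amplitude of a stabilizer state at a point of its affine support. -/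
theorem stab_amplitude {m k : ℕ} (x₀ : Fin m → ZMod 3)
    (W : (Fin k → ZMod 3) →ₗ[ZMod 3] (Fin m → ZMod 3)) (hW : Function.Injective W)
    (Q : (Fin k → ZMod 3) → ZMod 3) (z : Fin k → ZMod 3) :
    (∑ y : Fin k → ZMod 3, if x₀ + W z = x₀ + W y then ωp (Q y) else 0) = ωp (Q z) := by
  simp [hW.eq_iff]

/-- The support of a stabilizer state is closed under `(x, y) ↦ -x - y`, the third point
of the affine line through `x` and `y`. -/
theorem IsStab.apply_neg_sub_ne_zero {m : ℕ} {σ : QS m} (hσ : IsStab σ)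
    {x y : Fin m → ZMod 3} (hx : σ x ≠ 0) (hy : σ y ≠ 0) : σ (-x - y) ≠ 0 := by
  obtain ⟨k, -, x₀, W, Q, hW, -, rfl⟩ := hσ
  have mem_range : ∀ x, (((Real.sqrt (3 ^ k) : ℝ) : ℂ)⁻¹ *
      ∑ y : Fin k → ZMod 3, if x = x₀ + W y then ωp (Q y) else 0) ≠ 0 → ∃ y, x = x₀ + W y := by
    intro x h
    by_contra! hne
    simp [hne] at h
  obtain ⟨u, rfl⟩ := mem_range x hx
  obtain ⟨v, rfl⟩ := mem_range y hy
  have three : ∀ a : ZMod 3, -a - a = a := by decide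
  have hz : -(x₀ + W u) - (x₀ + W v) = x₀ + W (-u - v) := by
    ext i
    have := three (x₀ i)
    simp only [map_sub, map_neg, Pi.add_apply, Pi.sub_apply, Pi.neg_apply]
    linear_combination this
  simp only [hz, stab_amplitude x₀ W hW Q]
  refine mul_ne_zero (inv_ne_zero ?_) (pow_ne_zero _ omega_ne_zero)
  exact Complex.ofReal_ne_zero.2 (by positivity)

theorem strange_zero : Strange 0 = 0 := by
  simp [Strange, show (0 : ZMod 3) ≠ 2 by decide]

theorem strange_one : Strange 1 = 1 / (Real.sqrt 2 : ℂ) := by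
  simp [Strange, show (1 : ZMod 3) ≠ 2 by decide]

theorem strange_two : Strange 2 = -1 / (Real.sqrt 2 : ℂ) := by
  simp [Strange, show (2 : ZMod 3) ≠ 1 by decide]

theorem tpow_strange_two_ne_smul {σ : QS 2} (hσ : IsStab σ) (c : ℂ) :
    tpow Strange 2 ≠ c • σ := by
  intro h
  have hval : ∀ x, c * σ x = Strange (x 0) * Strange (x 1) := by
    intro x
    simpa [tpow, Fin.prod_univ_two] using (congrFun h x).symm
  have h11 : c * σ ![1, 1] ≠ 0 := by
    rw [hval]; simp [strange_one]
  have h12 : c * σ ![1, 2] ≠ 0 := by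
    rw [hval]; simp [strange_one, strange_two]
  have h10 := hval (-![1, 1] - ![1, 2])
  have hzero : (-![1, 1] - ![1, 2] : Fin 2 → ZMod 3) 1 = 0 := by decide
  rw [hzero, strange_zero, mul_zero] at h10
  exact mul_ne_zero (left_ne_zero_of_mul h11)
    (hσ.apply_neg_sub_ne_zero (right_ne_zero_of_mul h11) (right_ne_zero_of_mul h12)) h10

/-- The two-qutrit stabilizer state with phase polynomial `s * x₀ * x₁`. -/
def productPhase (s : ZMod 3) : QS 2 := fun x => (3 : ℂ)⁻¹ * ωp (s * x 0 * x 1)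

theorem productPhase_isStab (s : ZMod 3) : IsStab (productPhase s) := by
  refine ⟨2, le_rfl, 0, LinearMap.id, fun y => s * y 0 * y 1, Function.injective_id,
    ⟨![![0, s], ![0, 0]], 0, 0, fun y => by simp [Fin.sum_univ_two]⟩, ?_⟩
  have hsqrt : Real.sqrt (3 ^ 2) = 3 := Real.sqrt_sq (by norm_num)
  funext x
  simp [productPhase, hsqrt]

/-- The explicit two-term stabilizer decomposition of two copies of the Strange state. -/
theorem tpow_strange_two_eq :
    tpow Strange 2 = (3 / (2 * (ω - ω ^ 2))) • productPhase 1 +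
      (-(3 / (2 * (ω - ω ^ 2)))) • productPhase (-1) := by
  have hω := omega_sub_sq_ne_zero
  have hsqrt : (Real.sqrt 2 : ℂ) * (Real.sqrt 2 : ℂ) = 2 := by
    rw [← Complex.ofReal_mul, Real.mul_self_sqrt (by norm_num)]
    norm_num
  have hinv : (Real.sqrt 2 : ℂ)⁻¹ * (Real.sqrt 2 : ℂ)⁻¹ = 1 / 2 := by
    rw [← mul_inv, hsqrt, one_div]
  have hprod : ∀ a b : ZMod 3, Strange a * Strange b =
      (ωp (a * b) - ωp (-(a * b))) / (2 * (ω - ω ^ 2)) := by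
    have p0 : ωp 0 = 1 := by simp [ωp]
    have p1 : ωp 1 = ω := by simp [ωp, ZMod.val_one]
    have p2 : ωp 2 = ω ^ 2 := rfl
    have hplus : (ω - ω ^ 2) / (2 * (ω - ω ^ 2)) = 1 / 2 := by
      rw [div_eq_div_iff (mul_ne_zero two_ne_zero hω) two_ne_zero]; ring
    have hminus : (ω ^ 2 - ω) / (2 * (ω - ω ^ 2)) = -(1 / 2) := by
      rw [← hplus]; ring
    have cases3 : ∀ a : ZMod 3, a = 0 ∨ a = 1 ∨ a = 2 := by decide
    have n1 : (-1 : ZMod 3) = 2 := by decide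
    have n2 : (-2 : ZMod 3) = 1 := by decide
    have m22 : (2 * 2 : ZMod 3) = 1 := by decide
    intro a b
    rcases cases3 a with rfl | rfl | rfl <;> rcases cases3 b with rfl | rfl | rfl <;>
      simp only [strange_zero, strange_one, strange_two, zero_mul, mul_zero, one_mul, mul_one,
        neg_zero, n1, n2, m22, p0, p1, p2, sub_self, zero_div, hplus, hminus] <;>
      first
        | done
        | linear_combination hinv
        | linear_combination -hinv
  funext x
  simp only [tpow, Fin.prod_univ_two, hprod, Pi.add_apply, Pi.smul_apply, smul_eq_mul,
    productPhase, one_mul, neg_mul]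
  ring

/-- `|𝕊⟩^{⊗2}` is not a scalar multiple of any canonical 2-qutrit stabilizer
state, and `χ(|𝕊⟩^{⊗2}) = 2`. -/
theorem strange_m2_rank_two :
    (∀ σ : QS 2, IsStab σ → ∀ c : ℂ, tpow Strange 2 ≠ c • σ) ∧
    stabRank (tpow Strange 2) = 2 := by
  refine ⟨fun σ hσ c => tpow_strange_two_ne_smul hσ c, ?_⟩
  have hmem : 2 ∈ {r : ℕ | ∃ (c : Fin r → ℂ) (σ : Fin r → QS 2),
      (∀ i, IsStab (σ i)) ∧ tpow Strange 2 = ∑ i, c i • σ i} :=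
    ⟨![3 / (2 * (ω - ω ^ 2)), -(3 / (2 * (ω - ω ^ 2)))], ![productPhase 1, productPhase (-1)],
      fun i => by fin_cases i <;> exact productPhase_isStab _,
      by simpa [Fin.sum_univ_two] using tpow_strange_two_eq⟩
  refine le_antisymm (Nat.sInf_le hmem) (le_csInf ⟨2, hmem⟩ ?_)
  rintro r ⟨c, σ, hσ, h⟩
  by_contra! hr
  interval_cases r
  · exact tpow_strange_two_ne_smul (productPhase_isStab 0) 0 (by simpa using h)
  · exact tpow_strange_two_ne_smul (hσ 0) (c 0) (by simpa using h)
end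
end

section
/- Let σ₁ = |0⟩⊗|+⟩, σ₂ = |+⟩⊗|0⟩ (where |+⟩ = (|0⟩+|1⟩+|2⟩)/√3), and let σ₃ be the two-qutrit vector with amplitudes σ₃(y) = (1/3)·ω^{2y₀² + y₁²} for all y ∈ 𝔽₃² (exponents mod 3). With α₁ = (c√3/N²)(1 − cω), α₂ = (c√3/N²)(1 − cω²), α₃ = 3c²/N², one has |H₃⟩^{⊗2} = α₁σ₁ + α₂σ₂ + α₃σ₃. All three σⱼ are canonical 2-qutrit stabilizer states, so χ(|H₃⟩^{⊗2}) ≤ 3. -/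
open Complex
open scoped BigOperators

noncomputable section

/-- `c = (√3 - 1)/2`. -/
def cst : ℝ := (Real.sqrt 3 - 1) / 2

/-- `N = √(3 - √3)`. -/
def Nst : ℝ := Real.sqrt (3 - Real.sqrt 3)

/-- The Hadamard-eigenstate `|H₃⟩ = (1/N)(|0⟩ + c|1⟩ + c|2⟩)`. -/
def H3 : ZMod 3 → ℂ := fun j =>
  ((Nst : ℝ) : ℂ)⁻¹ * ((if j = 0 then 1 else 0) + (cst : ℂ) * (if j = 1 then 1 else 0)
    + (cst : ℂ) * (if j = 2 then 1 else 0))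

/-- `σ₁ = |0⟩ ⊗ |+⟩`. -/
def σH1 : QS 2 := fun y => (if y 0 = 0 then 1 else 0) * ((Real.sqrt 3 : ℝ) : ℂ)⁻¹

/-- `σ₂ = |+⟩ ⊗ |0⟩`. -/
def σH2 : QS 2 := fun y => ((Real.sqrt 3 : ℝ) : ℂ)⁻¹ * (if y 1 = 0 then 1 else 0)

/-- `σ₃(y) = (1/3)·ω^{2y₀² + y₁²}`. -/
def σH3 : QS 2 := fun y => (1 / 3 : ℂ) * ωp (2 * y 0 ^ 2 + y 1 ^ 2)

/-- The linear embedding of `𝔽₃` onto the coordinate axis `j` of `𝔽₃²`. -/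
def axisMap (j : Fin 2) : (Fin 1 → ZMod 3) →ₗ[ZMod 3] (Fin 2 → ZMod 3) :=
  LinearMap.single (ZMod 3) (fun _ : Fin 2 => ZMod 3) j ∘ₗ LinearMap.proj 0

lemma axisMap_injective (j : Fin 2) : Function.Injective (axisMap j) := by
  intro a b h
  ext i
  fin_cases i
  simpa [axisMap] using h

lemma isDeg2_zero {k : ℕ} : IsDeg2 (fun _ : Fin k → ZMod 3 => 0) :=
  ⟨0, 0, 0, by simp⟩

lemma sum_axisMap (j : Fin 2) (x : Fin 2 → ZMod 3) :
    (∑ y : Fin 1 → ZMod 3, if x = 0 + axisMap j y then ωp 0 else 0) =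
      if x (1 - j) = 0 then 1 else 0 := by
  have key : ∀ y : Fin 1 → ZMod 3,
      x = 0 + axisMap j y ↔ x (1 - j) = 0 ∧ y = fun _ => x j := by
    intro y
    fin_cases j <;> simp [axisMap, funext_iff, Fin.forall_fin_two, eq_comm, and_comm]
  simp_rw [key, ite_and]
  split_ifs <;> simp [ωp]

lemma isStab_σH1 : IsStab σH1 := by
  refine ⟨1, by norm_num, 0, axisMap 1, fun _ => 0, axisMap_injective 1, isDeg2_zero, ?_⟩
  funext x
  rw [sum_axisMap]
  simp [σH1, mul_comm]

lemma isStab_σH2 : IsStab σH2 := by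
  refine ⟨1, by norm_num, 0, axisMap 0, fun _ => 0, axisMap_injective 0, isDeg2_zero, ?_⟩
  funext x
  rw [sum_axisMap]
  simp [σH2]

lemma isStab_σH3 : IsStab σH3 := by
  refine ⟨2, le_rfl, 0, LinearMap.id, fun y => 2 * y 0 ^ 2 + y 1 ^ 2, Function.injective_id,
    ⟨!![2, 0; 0, 1], 0, 0, fun y => ?_⟩, ?_⟩
  · simp [Fin.sum_univ_two]
    ring
  · funext x
    simp [σH3]

lemma ω_sq_add_ω : ω ^ 2 + ω + 1 = 0 := by
  have hprim : IsPrimitiveRoot ω 3 := by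
    simpa [ω] using Complex.isPrimitiveRoot_exp 3 (by norm_num)
  have h := hprim.geom_sum_eq_zero (by norm_num)
  simp only [Finset.sum_range_succ, Finset.sum_range_zero] at h
  linear_combination h

lemma Nst_pos : 0 < Nst :=
  Real.sqrt_pos.2 <| sub_pos.2 <| (Real.sqrt_lt' (by norm_num)).2 (by norm_num)

lemma two_mul_cst_mul : 2 * (cst : ℂ) * (1 + cst) = 1 := by
  have h : (2 * cst * (1 + cst) : ℝ) = 1 := by
    have := Real.sq_sqrt (show (0 : ℝ) ≤ 3 by norm_num)
    unfold cst
    linear_combination this / 2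
  exact_mod_cast h

lemma H3_zero : H3 0 = (Nst : ℂ)⁻¹ := by
  have h1 : (0 : ZMod 3) ≠ 1 := by decide
  have h2 : (0 : ZMod 3) ≠ 2 := by decide
  simp [H3, h1, h2]

lemma H3_of_ne_zero {j : ZMod 3} (hj : j ≠ 0) : H3 j = (Nst : ℂ)⁻¹ * cst := by
  have h12 : (1 : ZMod 3) ≠ 2 := by decide
  have h : j = 1 ∨ j = 2 := by
    revert j
    decide
  rcases h with rfl | rfl
  · simp [H3, h12]
  · simp [H3, hj, h12.symm]

lemma sq_eq_one_of_ne_zero {j : ZMod 3} (hj : j ≠ 0) : j ^ 2 = 1 := by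
  revert j
  decide

lemma tpow_H3_two :
    tpow H3 2 =
      ((((cst * Real.sqrt 3) / Nst ^ 2 : ℝ) : ℂ) * (1 - (cst : ℂ) * ω)) • σH1 +
      ((((cst * Real.sqrt 3) / Nst ^ 2 : ℝ) : ℂ) * (1 - (cst : ℂ) * ω ^ 2)) • σH2 +
      (((3 * cst ^ 2 / Nst ^ 2 : ℝ) : ℂ)) • σH3 := by
  have hN : (Nst : ℂ) ≠ 0 := by exact_mod_cast Nst_pos.ne'
  have hs : ((Real.sqrt 3 : ℝ) : ℂ) ≠ 0 := by
    exact_mod_cast (Real.sqrt_pos.2 (by norm_num : (0 : ℝ) < 3)).ne'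
  have hc := two_mul_cst_mul
  have hω := ω_sq_add_ω
  funext y
  simp only [tpow, Fin.prod_univ_two, σH1, σH2, σH3, Pi.add_apply, Pi.smul_apply, smul_eq_mul]
  push_cast
  generalize y 0 = a
  generalize y 1 = b
  by_cases ha : a = 0 <;> by_cases hb : b = 0
  · have w : ωp (2 * a ^ 2 + b ^ 2) = 1 := by simp [ha, hb, ωp]
    rw [w, ha, hb, H3_zero, if_pos rfl]
    field_simp
    linear_combination -hc + cst ^ 2 * hω
  · have w : ωp (2 * a ^ 2 + b ^ 2) = ω := by
      rw [ha, sq_eq_one_of_ne_zero hb]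
      exact pow_one ω
    rw [w, ha, H3_zero, H3_of_ne_zero hb, if_pos rfl, if_neg hb]
    field_simp
    ring
  · have w : ωp (2 * a ^ 2 + b ^ 2) = ω ^ 2 := by
      rw [hb, sq_eq_one_of_ne_zero ha]
      rfl
    rw [w, hb, H3_zero, H3_of_ne_zero ha, if_pos rfl, if_neg ha]
    field_simp
    ring
  · have w : ωp (2 * a ^ 2 + b ^ 2) = 1 := by
      rw [sq_eq_one_of_ne_zero ha, sq_eq_one_of_ne_zero hb]
      exact pow_zero ω
    rw [w, H3_of_ne_zero ha, H3_of_ne_zero hb, if_neg ha, if_neg hb]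
    field_simp
    ring

/-- with `α₁ = (c√3/N²)(1 - cω)`, `α₂ = (c√3/N²)(1 - cω²)`, `α₃ = 3c²/N²`,
`|H₃⟩^{⊗2} = α₁σ₁ + α₂σ₂ + α₃σ₃`; all three are canonical 2-qutrit stabilizer states,
so `χ(|H₃⟩^{⊗2}) ≤ 3`. -/
theorem h3_m2_decomposition :
    tpow H3 2 =
      ((((cst * Real.sqrt 3) / Nst ^ 2 : ℝ) : ℂ) * (1 - (cst : ℂ) * ω)) • σH1 +
      ((((cst * Real.sqrt 3) / Nst ^ 2 : ℝ) : ℂ) * (1 - (cst : ℂ) * ω ^ 2)) • σH2 +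
      (((3 * cst ^ 2 / Nst ^ 2 : ℝ) : ℂ)) • σH3 ∧
    IsStab σH1 ∧ IsStab σH2 ∧ IsStab σH3 ∧
    stabRank (tpow H3 2) ≤ 3 := by
  refine ⟨tpow_H3_two, isStab_σH1, isStab_σH2, isStab_σH3, Nat.sInf_le ?_⟩
  refine ⟨![((cst * Real.sqrt 3 / Nst ^ 2 : ℝ) : ℂ) * (1 - cst * ω),
    ((cst * Real.sqrt 3 / Nst ^ 2 : ℝ) : ℂ) * (1 - cst * ω ^ 2),
    ((3 * cst ^ 2 / Nst ^ 2 : ℝ) : ℂ)], ![σH1, σH2, σH3], ?_, ?_⟩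
  · intro i
    fin_cases i
    exacts [isStab_σH1, isStab_σH2, isStab_σH3]
  · rw [Fin.sum_univ_three]
    exact tpow_H3_two
end
end

section
/- Define four three-qutrit vectors, each with amplitude (1/3)·ω^{Q(w)} at the indicated points (w ∈ 𝔽₃², exponents mod 3, amplitude 0 elsewhere), except σ₃: σ₁ at points (2,w₀,w₁) with Q₁(w) = w₀ + 2w₀² + 2w₁ + w₁²; σ₂ at points (w₀,2,w₁) with Q₂(w) = 2w₀ + w₀² + w₁ + 2w₁²; σ₄ at points (w₀,w₁,2) with Q₄(w) = w₀ + 2w₀² + 2w₁ + w₁²; and σ₃ = |+⟩⊗|+⟩⊗|+⟩ where |+⟩ = (|0⟩+|1⟩+|2⟩)/√3. Then |ℕ⟩^{⊗3} = −(√6/4)(σ₁ + σ₂ + σ₄) + (√2/4)σ₃. All four σⱼ are canonical 3-qutrit stabilizer states, so χ(|ℕ⟩^{⊗3}) ≤ 4. -/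
open Complex
open scoped BigOperators

noncomputable section

/-- The Norrell state `|ℕ⟩ = (|0⟩ + |1⟩ - 2|2⟩)/√6`. -/
def Nor : ZMod 3 → ℂ := fun j =>
  ((if j = 0 then 1 else 0) + (if j = 1 then 1 else 0) - 2 * (if j = 2 then 1 else 0))
    / (Real.sqrt 6 : ℂ)

/-- `σ₁`: supported on `(2, w₀, w₁)` with `Q₁(w) = w₀ + 2w₀² + 2w₁ + w₁²`. -/
def σM1 : QS 3 := fun x =>
  if x 0 = 2 then (1 / 3 : ℂ) * ωp (x 1 + 2 * x 1 ^ 2 + 2 * x 2 + x 2 ^ 2) else 0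

/-- `σ₂`: supported on `(w₀, 2, w₁)` with `Q₂(w) = 2w₀ + w₀² + w₁ + 2w₁²`. -/
def σM2 : QS 3 := fun x =>
  if x 1 = 2 then (1 / 3 : ℂ) * ωp (2 * x 0 + x 0 ^ 2 + x 2 + 2 * x 2 ^ 2) else 0

/-- `σ₄`: supported on `(w₀, w₁, 2)` with `Q₄(w) = w₀ + 2w₀² + 2w₁ + w₁²`. -/
def σM4 : QS 3 := fun x =>
  if x 2 = 2 then (1 / 3 : ℂ) * ωp (x 0 + 2 * x 0 ^ 2 + 2 * x 1 + x 1 ^ 2) else 0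

/-- `σ₃ = |+⟩ ⊗ |+⟩ ⊗ |+⟩`. -/
def σM3 : QS 3 := fun _ => ((Real.sqrt (3 ^ 3) : ℝ) : ℂ)⁻¹

lemma one_add_omega_add_omega_sq : 1 + ω + ω ^ 2 = 0 := by
  have h : IsPrimitiveRoot ω 3 := by
    simpa [ω] using Complex.isPrimitiveRoot_exp 3 (by norm_num)
  simpa [Finset.sum_range_succ] using h.geom_sum_eq_zero (by norm_num)

/-- The quadratic phase state on the affine hyperplane `x i = a` is a stabilizer state. -/
lemma isStab_hyperplane {m : ℕ} (i : Fin (m + 1)) (a : ZMod 3)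
    {Q : (Fin m → ZMod 3) → ZMod 3} (hQ : IsDeg2 Q) :
    IsStab fun x : Fin (m + 1) → ZMod 3 =>
      if x i = a then ((Real.sqrt (3 ^ m) : ℝ) : ℂ)⁻¹ * ωp (Q (i.removeNth x)) else 0 := by
  let W : (Fin m → ZMod 3) →ₗ[ZMod 3] (Fin (m + 1) → ZMod 3) :=
    { toFun := fun y => i.insertNth (α := fun _ => ZMod 3) 0 y
      map_add' := fun y z => by simp [← Fin.insertNth_add]
      map_smul' := fun c y => by
        ext j
        refine i.succAboveCases ?_ (fun l => ?_) j <;> simp }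
  refine ⟨m, m.le_succ, Pi.single i a, W, Q, fun y z h => ?_, hQ, ?_⟩
  · ext j
    simpa [W] using congrFun h (i.succAbove j)
  · ext x
    have hx : ∀ y, x = Pi.single i a + W y ↔ x i = a ∧ i.removeNth x = y := by
      intro y
      rw [funext_iff, i.forall_iff_succAbove, funext_iff]
      simp [W, Fin.removeNth]
    simp only [hx]
    by_cases h : x i = a <;> simp [h]

/-- The quadratic phase state with full support is a stabilizer state. -/
lemma isStab_full {m : ℕ} {Q : (Fin m → ZMod 3) → ZMod 3} (hQ : IsDeg2 Q) :
    IsStab fun x : Fin m → ZMod 3 => ((Real.sqrt (3 ^ m) : ℝ) : ℂ)⁻¹ * ωp (Q x) :=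
  ⟨m, le_rfl, 0, LinearMap.id, Q, Function.injective_id, hQ, by simp⟩

lemma isDeg2_diagonal (a b c d : ZMod 3) :
    IsDeg2 fun y : Fin 2 → ZMod 3 => a * y 0 + b * y 0 ^ 2 + c * y 1 + d * y 1 ^ 2 :=
  ⟨!![b, 0; 0, d], ![a, c], 0, fun y => by simp [Fin.sum_univ_two]; ring⟩

lemma sqrt_three_sq_inv : ((Real.sqrt (3 ^ 2) : ℝ) : ℂ)⁻¹ = 1 / 3 := by
  rw [Real.sqrt_sq (by norm_num)]
  norm_num

lemma isStab_σM1 : IsStab σM1 := by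
  convert isStab_hyperplane (0 : Fin 3) 2 (isDeg2_diagonal 1 2 2 1) using 2 with x
  simp only [sqrt_three_sq_inv]
  simp [σM1, Fin.removeNth]

lemma isStab_σM2 : IsStab σM2 := by
  convert isStab_hyperplane (1 : Fin 3) 2 (isDeg2_diagonal 2 1 1 2) using 2 with x
  simp only [sqrt_three_sq_inv]
  simp [σM2, Fin.removeNth, Fin.succAbove]

lemma isStab_σM4 : IsStab σM4 := by
  convert isStab_hyperplane (2 : Fin 3) 2 (isDeg2_diagonal 1 2 2 1) using 2 with x
  simp only [sqrt_three_sq_inv]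
  simp [σM4, Fin.removeNth, Fin.succAbove]

lemma isStab_σM3 : IsStab σM3 := by
  convert isStab_full (m := 3) (Q := fun _ => 0) ⟨0, 0, 0, by simp⟩ using 2 with x
  simp [σM3, ωp]

lemma tpow_nor_three :
    tpow Nor 3 =
      (-((Real.sqrt 6 : ℂ) / 4)) • (σM1 + σM2 + σM4) + ((Real.sqrt 2 : ℂ) / 4) • σM3 := by
  have hω := one_add_omega_add_omega_sq
  have h2 : ((Real.sqrt 2 : ℝ) : ℂ) ^ 2 = 2 := by
    exact_mod_cast Real.sq_sqrt (by norm_num : (0 : ℝ) ≤ 2)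
  have h3 : ((Real.sqrt 3 : ℝ) : ℂ) ^ 2 = 3 := by
    exact_mod_cast Real.sq_sqrt (by norm_num : (0 : ℝ) ≤ 3)
  have h6 : ((Real.sqrt 6 : ℝ) : ℂ) = (Real.sqrt 2 : ℝ) * (Real.sqrt 3 : ℝ) := by
    rw [← Complex.ofReal_mul, ← Real.sqrt_mul (by norm_num)]
    norm_num
  have h27 : ((Real.sqrt (3 ^ 3) : ℝ) : ℂ) = 3 * (Real.sqrt 3 : ℝ) := by
    rw [pow_succ, Real.sqrt_mul (by norm_num), Real.sqrt_sq (by norm_num), Complex.ofReal_mul]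
    norm_num
  have h6sq : ((Real.sqrt 6 : ℝ) : ℂ) ^ 2 = 6 := by rw [h6, mul_pow, h2, h3]; norm_num
  have h6ne : ((Real.sqrt 6 : ℝ) : ℂ) ≠ 0 := fun h => by simp [h] at h6sq
  have h3ne : ((Real.sqrt 3 : ℝ) : ℂ) ≠ 0 := fun h => by simp [h] at h3
  have hplus : ((Real.sqrt 2 : ℝ) : ℂ) / 4 * (3 * ((Real.sqrt 3 : ℝ) : ℂ))⁻¹ =
      (Real.sqrt 6 : ℝ) / 36 := by
    rw [h6]
    field_simp
    linear_combination -12 * h3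
  have htri : ∀ a : ZMod 3, a = 0 ∨ a = 1 ∨ a = 2 := by decide
  have hNor : ∀ a, Nor a = (Real.sqrt 6 : ℝ) / 6 * if a = 2 then -2 else 1 := by
    intro a
    have hinv : (((Real.sqrt 6 : ℝ) : ℂ))⁻¹ = (Real.sqrt 6 : ℝ) / 6 := by
      field_simp
      exact h6sq.symm
    rw [Nor, div_eq_mul_inv, hinv, mul_comm]
    congr 1
    obtain rfl | rfl | rfl := htri a <;> simp +decide
  ext x
  simp only [tpow, Fin.prod_univ_three, Pi.add_apply, Pi.smul_apply, smul_eq_mul, σM1, σM2,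
    σM3, σM4, h27, hplus, hNor]
  generalize x 0 = a, x 1 = b, x 2 = c
  have key : ((if a = 2 then -2 else 1) * (if b = 2 then -2 else 1) *
      (if c = 2 then -2 else 1) : ℂ) =
      -3 * ((if a = 2 then ωp (b + 2 * b ^ 2 + 2 * c + c ^ 2) else 0) +
        (if b = 2 then ωp (2 * a + a ^ 2 + c + 2 * c ^ 2) else 0) +
        (if c = 2 then ωp (a + 2 * a ^ 2 + 2 * b + b ^ 2) else 0)) + 1 := by
    have a1 : (1 + 1 : ZMod 3) = 2 := rfl
    have a2 : (1 + 2 : ZMod 3) = 0 := rfl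
    have a3 : (2 + 1 : ZMod 3) = 0 := rfl
    have a4 : (2 + 2 : ZMod 3) = 1 := rfl
    have m2 : (2 * 2 : ZMod 3) = 1 := rfl
    have p2 : (2 ^ 2 : ZMod 3) = 1 := rfl
    have e0 : ωp 0 = 1 := by simp [ωp]
    have e1 : ωp 1 = ω := by simp [ωp, ZMod.val_one]
    have e2 : ωp 2 = -1 - ω := by
      have : ωp 2 = ω ^ 2 := rfl
      linear_combination this + hω
    obtain rfl | rfl | rfl := htri a <;> obtain rfl | rfl | rfl := htri b <;>
      obtain rfl | rfl | rfl := htri c <;> simp +decide [a1, a2, a3, a4, m2, p2, e0, e1, e2] <;>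
      ring
  simp only [← mul_ite_zero]
  linear_combination ((Real.sqrt 6 : ℝ) : ℂ) / 36 * key + ((Real.sqrt 6 : ℝ) : ℂ) / 216 *
    ((if a = 2 then -2 else 1) * (if b = 2 then -2 else 1) * (if c = 2 then -2 else 1)) * h6sq

lemma stabRank_le {m r : ℕ} {ψ : QS m} (c : Fin r → ℂ) (σ : Fin r → QS m)
    (hσ : ∀ i, IsStab (σ i)) (hψ : ψ = ∑ i, c i • σ i) : stabRank ψ ≤ r :=
  Nat.sInf_le ⟨c, σ, hσ, hψ⟩

/-- `|ℕ⟩^{⊗3} = -(√6/4)(σ₁ + σ₂ + σ₄) + (√2/4)σ₃`; all four are canonical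
3-qutrit stabilizer states, so `χ(|ℕ⟩^{⊗3}) ≤ 4`. -/
theorem norrell_m3_decomposition :
    tpow Nor 3 =
      (-((Real.sqrt 6 : ℂ) / 4)) • (σM1 + σM2 + σM4) + ((Real.sqrt 2 : ℂ) / 4) • σM3 ∧
    IsStab σM1 ∧ IsStab σM2 ∧ IsStab σM3 ∧ IsStab σM4 ∧
    stabRank (tpow Nor 3) ≤ 4 := by
  refine ⟨tpow_nor_three, isStab_σM1, isStab_σM2, isStab_σM3, isStab_σM4,
    stabRank_le ![-((Real.sqrt 6 : ℂ) / 4), -((Real.sqrt 6 : ℂ) / 4), -((Real.sqrt 6 : ℂ) / 4),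
      (Real.sqrt 2 : ℂ) / 4] ![σM1, σM2, σM4, σM3] ?_ ?_⟩
  · simp [Fin.forall_fin_succ, isStab_σM1, isStab_σM2, isStab_σM3, isStab_σM4]
  · simp [tpow_nor_three, Fin.sum_univ_four, smul_add]
end
end

section
/- Let |T⟩ = cos β·|0⟩ + e^{iπ/4} sin β·|1⟩ with cos(2β) = 1/√3 and β ∈ (0, π/4). Define three 4-qubit vectors by their amplitudes at x ∈ 𝔽₂⁴: σ₁(x) = 2^{−3/2}·i^{x₁}·(−1)^{x₂x₄} if x₁ = x₃ and 0 otherwise; σ₂(x) = 2^{−2}·i^{x₂+x₄}·(−1)^{x₁x₃ + x₂x₄}; σ₃(x) = 2^{−3/2}·i^{x₁+x₂+x₃}·(−1)^{x₁x₃} if x₂ = x₄ and 0 otherwise (here coordinates of x are labeled x₁,x₂,x₃,x₄ and exponents of i and −1 are computed from the integer representatives 0,1). Then |T⟩^{⊗4} = (2/3)e^{iπ/12}·σ₁ + (2/3)·σ₂ + (2/3)e^{−iπ/12}·σ₃. -/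
open Complex
open scoped BigOperators

noncomputable section

/-- A 4-qubit state is a vector of amplitudes indexed by `Fin 4 → ZMod 2`. -/
abbrev QB4 := (Fin 4 → ZMod 2) → ℂ

/-- The 4-fold tensor power of a single-qubit state. -/
def tpow4 (ψ : ZMod 2 → ℂ) : QB4 := fun x => ∏ i, ψ (x i)

/-- The qubit `T`-type magic state `|T⟩ = cos β |0⟩ + e^{iπ/4} sin β |1⟩`. -/
def Tstate (β : ℝ) : ZMod 2 → ℂ := fun j =>
  if j = 0 then (Real.cos β : ℂ) else Complex.exp (Real.pi * Complex.I / 4) * (Real.sin β : ℂ)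

/-- `σ₁(x) = 2^{-3/2}·i^{x₁}·(-1)^{x₂x₄}` on the support `x₁ = x₃`. -/
def σQ1 : QB4 := fun x =>
  if x 0 = x 2 then
    ((Real.sqrt (2 ^ 3) : ℝ) : ℂ)⁻¹ * Complex.I ^ (x 0).val *
      (-1 : ℂ) ^ ((x 1).val * (x 3).val)
  else 0

/-- `σ₂(x) = 2^{-2}·i^{x₂+x₄}·(-1)^{x₁x₃ + x₂x₄}` (full support). -/
def σQ2 : QB4 := fun x =>
  (4 : ℂ)⁻¹ * Complex.I ^ ((x 1).val + (x 3).val) *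
    (-1 : ℂ) ^ ((x 0).val * (x 2).val + (x 1).val * (x 3).val)

/-- `σ₃(x) = 2^{-3/2}·i^{x₁+x₂+x₃}·(-1)^{x₁x₃}` on the support `x₂ = x₄`. -/
def σQ3 : QB4 := fun x =>
  if x 1 = x 3 then
    ((Real.sqrt (2 ^ 3) : ℝ) : ℂ)⁻¹ * Complex.I ^ ((x 0).val + (x 1).val + (x 2).val) *
      (-1 : ℂ) ^ ((x 0).val * (x 2).val)
  else 0

theorem exp_pi_mul_I_div_four :
    Complex.exp (Real.pi * Complex.I / 4) = (Real.sqrt 2 : ℂ) / 2 * (1 + Complex.I) := by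
  rw [show (Real.pi * Complex.I / 4 : ℂ) = ((Real.pi / 4 : ℝ) : ℂ) * Complex.I by push_cast; ring,
    Complex.exp_mul_I, ← Complex.ofReal_cos, ← Complex.ofReal_sin, Real.cos_pi_div_four,
    Real.sin_pi_div_four]
  push_cast
  ring

theorem exp_pi_mul_I_div_three :
    Complex.exp (Real.pi * Complex.I / 3) = (1 + (Real.sqrt 3 : ℂ) * Complex.I) / 2 := by
  rw [show (Real.pi * Complex.I / 3 : ℂ) = ((Real.pi / 3 : ℝ) : ℂ) * Complex.I by push_cast; ring,
    Complex.exp_mul_I, ← Complex.ofReal_cos, ← Complex.ofReal_sin, Real.cos_pi_div_three,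
    Real.sin_pi_div_three]
  push_cast
  ring

theorem ofReal_sqrt_sq_s8 {r : ℝ} (hr : 0 ≤ r) : (Real.sqrt r : ℂ) ^ 2 = r := by
  exact_mod_cast Real.sq_sqrt hr

theorem inv_sqrt_two_pow_three :
    ((Real.sqrt (2 ^ 3) : ℝ) : ℂ)⁻¹ = (Real.sqrt 2 : ℂ) / 4 := by
  have h : Real.sqrt (2 ^ 3) = 2 * Real.sqrt 2 := by
    rw [Real.sqrt_eq_iff_mul_self_eq (by positivity) (by positivity)]
    linear_combination -4 * Real.sq_sqrt (show (0 : ℝ) ≤ 2 by norm_num)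
  have h0 : (Real.sqrt 2 : ℂ) ≠ 0 := by exact_mod_cast (by positivity : Real.sqrt 2 ≠ 0)
  have h2 := ofReal_sqrt_sq_s8 (show (0 : ℝ) ≤ 2 by norm_num)
  rw [h]
  push_cast at h2 ⊢
  field_simp
  linear_combination -2 * h2

theorem inv_sqrt_mul_exp_pi_mul_I_div_twelve :
    Complex.exp (Real.pi * Complex.I / 12) * ((Real.sqrt (2 ^ 3) : ℝ) : ℂ)⁻¹ =
      (1 + (Real.sqrt 3 : ℂ) * Complex.I) * (1 - Complex.I) / 8 := by
  have hexp : Complex.exp (Real.pi * Complex.I / 12) * Complex.exp (Real.pi * Complex.I / 4) =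
      Complex.exp (Real.pi * Complex.I / 3) := by
    rw [← Complex.exp_add]
    congr 1
    ring
  rw [exp_pi_mul_I_div_four, exp_pi_mul_I_div_three] at hexp
  rw [inv_sqrt_two_pow_three]
  linear_combination (1 - Complex.I) / 4 * hexp +
    Complex.exp (Real.pi * Complex.I / 12) * (Real.sqrt 2 : ℂ) / 8 * Complex.I_sq

theorem inv_sqrt_mul_exp_neg_pi_mul_I_div_twelve :
    Complex.exp (-(Real.pi * Complex.I) / 12) * ((Real.sqrt (2 ^ 3) : ℝ) : ℂ)⁻¹ =
      (1 - (Real.sqrt 3 : ℂ) * Complex.I) * (1 + Complex.I) / 8 := by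
  have h := congrArg (starRingEnd ℂ) inv_sqrt_mul_exp_pi_mul_I_div_twelve
  simp only [map_mul, map_div₀, map_inv₀, map_add, map_sub, map_one, ← Complex.exp_conj,
    Complex.conj_ofReal, Complex.conj_I, map_ofNat] at h
  rw [show (-(Real.pi * Complex.I) / 12 : ℂ) = Real.pi * -Complex.I / 12 by ring, h]
  ring

/-- for `β ∈ (0, π/4)` with `cos 2β = 1/√3`,
`|T⟩^{⊗4} = (2/3)e^{iπ/12}·σ₁ + (2/3)·σ₂ + (2/3)e^{-iπ/12}·σ₃`. -/
theorem qubit_T_m4_decomposition (β : ℝ) (hβ0 : 0 < β) (hβ1 : β < Real.pi / 4)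
    (hβ : Real.cos (2 * β) = 1 / Real.sqrt 3) :
    tpow4 (Tstate β) =
      ((2 / 3 : ℂ) * Complex.exp (Real.pi * Complex.I / 12)) • σQ1 +
      (2 / 3 : ℂ) • σQ2 +
      ((2 / 3 : ℂ) * Complex.exp (-(Real.pi * Complex.I) / 12)) • σQ3 := by
  have h3 : (Real.sqrt 3 : ℝ) ^ 2 = 3 := Real.sq_sqrt (by norm_num)
  have hβ' : Real.cos (2 * β) = Real.sqrt 3 / 3 := by
    rw [hβ]
    field_simp
    linarith
  have hc : Real.cos β ^ 2 = (1 + Real.sqrt 3 / 3) / 2 := by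
    linear_combination (1 / 2 : ℝ) * hβ' - (1 / 2 : ℝ) * Real.cos_two_mul β
  have hs : Real.sin β ^ 2 = (1 - Real.sqrt 3 / 3) / 2 := by
    linear_combination Real.sin_sq_add_cos_sq β - hc
  have hcs : Real.cos β * Real.sin β = Real.sqrt 2 * Real.sqrt 3 / 6 := by
    have hcpos : 0 < Real.cos β := Real.cos_pos_of_mem_Ioo ⟨by linarith, by linarith⟩
    have hspos : 0 < Real.sin β := Real.sin_pos_of_pos_of_lt_pi hβ0 (by linarith)
    rw [← sq_eq_sq₀ (by positivity) (by positivity), mul_pow, hc, hs, div_pow, mul_pow, h3,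
      Real.sq_sqrt (by norm_num)]
    linear_combination (-1 / 36 : ℝ) * h3
  have h2C : (Real.sqrt 2 : ℂ) ^ 2 = 2 := by exact_mod_cast ofReal_sqrt_sq_s8 zero_le_two
  have h3C : (Real.sqrt 3 : ℂ) ^ 2 = 3 := by exact_mod_cast h3
  have hcC : (Real.cos β : ℂ) ^ 2 = (1 + Real.sqrt 3 / 3) / 2 := by exact_mod_cast hc
  have hsC : (Real.sin β : ℂ) ^ 2 = (1 - Real.sqrt 3 / 3) / 2 := by exact_mod_cast hs
  have hcsC : (Real.cos β : ℂ) * Real.sin β = Real.sqrt 2 * Real.sqrt 3 / 6 := by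
    exact_mod_cast hcs
  have h00 : Tstate β 0 * Tstate β 0 = (1 + Real.sqrt 3 / 3) / 2 := by
    simp only [Tstate, if_true]
    linear_combination hcC
  have h01 : Tstate β 0 * Tstate β 1 = Real.sqrt 3 * (1 + Complex.I) / 6 := by
    simp only [Tstate, if_true, one_ne_zero, if_false, exp_pi_mul_I_div_four]
    linear_combination (Real.sqrt 2 : ℂ) / 2 * (1 + Complex.I) * hcsC +
      (Real.sqrt 3 : ℂ) * (1 + Complex.I) / 12 * h2C
  have h11 : Tstate β 1 * Tstate β 1 = Complex.I * (1 - Real.sqrt 3 / 3) / 2 := by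
    simp only [Tstate, one_ne_zero, if_false, exp_pi_mul_I_div_four]
    linear_combination ((Real.sqrt 2 : ℂ) / 2 * (1 + Complex.I)) ^ 2 * hsC +
      (1 + Complex.I) ^ 2 / 4 * (1 - (Real.sqrt 3 : ℂ) / 3) / 2 * h2C +
      (1 - (Real.sqrt 3 : ℂ) / 3) / 4 * Complex.I_sq
  have h10 : Tstate β 1 * Tstate β 0 = Real.sqrt 3 * (1 + Complex.I) / 6 := by
    rw [mul_comm, h01]
  have hbit : ∀ a : ZMod 2, a = 0 ∨ a = 1 := by decide
  have hval : (1 : ZMod 2).val = 1 := rfl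
  have hI := Complex.I_sq
  funext x
  have hL : tpow4 (Tstate β) x =
      (Tstate β (x 0) * Tstate β (x 1)) * (Tstate β (x 2) * Tstate β (x 3)) := by
    simp only [tpow4, Fin.prod_univ_four]
    ring
  have hR₁ := inv_sqrt_mul_exp_pi_mul_I_div_twelve
  have hR₃ := inv_sqrt_mul_exp_neg_pi_mul_I_div_twelve
  rw [hL]
  simp only [Pi.add_apply, Pi.smul_apply, smul_eq_mul, σQ1, σQ2, σQ3]
  generalize ((Real.sqrt (2 ^ 3) : ℝ) : ℂ)⁻¹ = r at *
  generalize Complex.exp (Real.pi * Complex.I / 12) = e₁ at *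
  generalize Complex.exp (-(Real.pi * Complex.I) / 12) = e₃ at *
  rcases hbit (x 0) with h0 | h0 <;> rcases hbit (x 1) with h1 | h1 <;>
    rcases hbit (x 2) with h2 | h2 <;> rcases hbit (x 3) with h3' | h3' <;>
    simp only [h0, h1, h2, h3', h00, h01, h10, h11, hval, ZMod.val_zero, if_true, one_ne_zero,
      zero_ne_one, if_false] <;>
    grind
end
end
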